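/- (Pointwise bound on the parametrix error L p⁰.) Assume in addition that a and λ are differentiable with bounded derivatives. For every c > 1 and τ > 0 there exists a constant C₀ > 0, depending only on c, τ, M, sup|a'| and sup|λ'|, such that for all x, y ∈ ℝ and all t < T with 0 < T − t ≤ τ, one has |L p⁰(t,x;T,y)| ≤ C₀ · [ (T−t)^{−1/2} Γ̄^{cM,cM,cM}(T−t, x−y) + (sup_{w∈ℝ} |λ'(w)|) · (𝒞_{cM} Γ̄^{cM,cM,cM}(T−t, ·))(x−y) ], where L acts on the backward variables (t,x). -/

import Mathlib

open Real MeasureTheory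

/-- Gaussian density component `Γ_n^{α,θ,ℓ}(t,x)`. -/
noncomputable def Gn (α θ l : ℝ) (n : ℕ) (t x : ℝ) : ℝ :=
  (Real.sqrt (2 * Real.pi * (α * t + (n : ℝ) * θ)))⁻¹ *
    Real.exp (-(x - (α / 2 + l * (Real.exp (θ / 2) - 1)) * t) ^ 2 / (2 * (α * t + (n : ℝ) * θ)))

/-- Compound-Poisson jump-diffusion density `Γ^{α,θ,ℓ}(t,x)`. -/
noncomputable def G (α θ l : ℝ) (t x : ℝ) : ℝ :=
  Real.exp (-(l * t)) * ∑' n : ℕ, (l * t) ^ n / (Nat.factorial n : ℝ) * Gn α θ l n t x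

/-- Centered Gaussian density component `Γ̄_n^{α,θ}(t,x)`. -/
noncomputable def GBn (α θ : ℝ) (n : ℕ) (t x : ℝ) : ℝ :=
  (Real.sqrt (2 * Real.pi * (α * t + (n : ℝ) * θ)))⁻¹ *
    Real.exp (-x ^ 2 / (2 * (α * t + (n : ℝ) * θ)))

/-- Centered jump-diffusion density `Γ̄^{α,θ,ℓ}(t,x)`. -/
noncomputable def GB (α θ l : ℝ) (t x : ℝ) : ℝ :=
  Real.exp (-(l * t)) * ∑' n : ℕ, (l * t) ^ n / (Nat.factorial n : ℝ) * GBn α θ n t x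

/-- Gaussian convolution operator `𝒞_θ`. -/
noncomputable def conv (θ : ℝ) (f : ℝ → ℝ) (x : ℝ) : ℝ :=
  ∫ z : ℝ, f (x + z) * ((Real.sqrt (2 * Real.pi * θ))⁻¹ * Real.exp (-z ^ 2 / (2 * θ)))

/-- Zeroth-order parametrix `p⁰(t,x;T,y) := Γ^{a(y),δ²,λ(y)}(T−t, x−y)`. -/
noncomputable def p0 (a lam : ℝ → ℝ) (δ : ℝ) (t x T y : ℝ) : ℝ :=
  G (a y) (δ ^ 2) (lam y) (T - t) (x - y)

/-- The variable-coefficient integro-differential operator `L`, acting on the backward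
variables `(t,x)`. -/
noncomputable def Lop (a lam : ℝ → ℝ) (δ : ℝ) (u : ℝ → ℝ → ℝ) (t x : ℝ) : ℝ :=
  deriv (fun s => u s x) t
    + a x / 2 * (deriv (deriv (u t)) x - deriv (u t) x)
    - lam x * (Real.exp (δ ^ 2 / 2) - 1) * deriv (u t) x
    + lam x * ∫ z : ℝ, (u t (x + z) - u t x) *
        ((Real.sqrt (2 * Real.pi * δ ^ 2))⁻¹ * Real.exp (-z ^ 2 / (2 * δ ^ 2)))


/-- The centered Gaussian density with variance `v`. -/
noncomputable def gauss (v y : ℝ) : ℝ :=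
  (√(2 * π * v))⁻¹ * exp (-y ^ 2 / (2 * v))

lemma gauss_nonneg (v y : ℝ) : 0 ≤ gauss v y := by unfold gauss; positivity

lemma hasDerivAt_gauss_comp {v y : ℝ → ℝ} {v' y' s : ℝ} (hs : 0 < v s)
    (hv : HasDerivAt v v' s) (hy : HasDerivAt y y' s) :
    HasDerivAt (fun r => gauss (v r) (y r))
      (v' / 2 * ((y s ^ 2 / v s ^ 2 - 1 / v s) * gauss (v s) (y s))
        + y' * (-(y s) / v s * gauss (v s) (y s))) s := by
  unfold gauss
  have hp : 0 < 2 * π * v s := by positivity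
  have h1 := ((hv.const_mul (2 * π)).sqrt hp.ne').fun_inv (Real.sqrt_pos.2 hp).ne'
  have h2 := (((hy.fun_pow 2).fun_neg).fun_div (hv.const_mul 2) (by positivity)).exp
  refine (h1.mul h2).congr_deriv ?_
  have hq : 0 < √(2 * π * v s) := Real.sqrt_pos.2 hp
  have e : √(2 * π * v s) ^ 2 = 2 * π * v s := Real.sq_sqrt hp.le
  rw [e]
  field_simp
  ring

lemma hasDerivAt_gauss {v : ℝ} (hv : 0 < v) (m x : ℝ) :
    HasDerivAt (fun x => gauss v (x - m)) (-(x - m) / v * gauss v (x - m)) x := by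
  have h := hasDerivAt_gauss_comp (v := fun _ => v) (y := fun x => x - m) hv
    (hasDerivAt_const x v) ((hasDerivAt_id x).sub_const m)
  simpa using h

lemma hasDerivAt_deriv_gauss {v : ℝ} (hv : 0 < v) (m x : ℝ) :
    HasDerivAt (fun x => -(x - m) / v * gauss v (x - m))
      (((x - m) ^ 2 / v ^ 2 - 1 / v) * gauss v (x - m)) x := by
  have h := ((((hasDerivAt_id x).sub_const m).fun_neg).div_const v).fun_mul
    (hasDerivAt_gauss hv m x)
  refine h.congr_deriv ?_
  simp only [id]
  field_simp
  ring

lemma one_add_pow_three_le {ε : ℝ} (hε : 0 < ε) {r : ℝ} :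
    (1 + r) ^ 3 ≤ (2 + 3 / ε) ^ 3 * exp (ε * r ^ 2) := by
  have h1 : 1 + r ≤ (2 + 3 / ε) * exp (ε * r ^ 2 / 3) := by
    have h2 := Real.add_one_le_exp (ε * r ^ 2 / 3)
    have h3 : 1 + r ≤ (2 + 3 / ε) * (ε * r ^ 2 / 3 + 1) := by
      have : (2 + 3 / ε) * (ε * r ^ 2 / 3 + 1) = 2 * ε * r ^ 2 / 3 + 2 + r ^ 2 + 3 / ε := by
        field_simp; ring
      rw [this]
      have : 0 ≤ 2 * ε * r ^ 2 / 3 := by positivity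
      have : 0 < 3 / ε := by positivity
      nlinarith [sq_nonneg (r - 1), sq_nonneg r]
    exact h3.trans (by gcongr)
  have h4 : (1 + r) ^ 3 ≤ ((2 + 3 / ε) * exp (ε * r ^ 2 / 3)) ^ 3 :=
    (Odd.strictMono_pow (by decide : Odd 3)).monotone h1
  refine h4.trans (le_of_eq ?_)
  rw [mul_pow, ← Real.exp_nat_mul]
  congr 2
  push_cast
  ring

/-- A Gaussian shifted by `m = O(√v)`, times a cubic weight, is dominated by a centered Gaussian
of larger variance. -/
lemma weighted_exp_le {c B v m X : ℝ} (hc : 1 < c) (hv : 0 < v) (hm : m ^ 2 ≤ B * v) :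
    (1 + |X - m| / √v) ^ 3 * exp (-(X - m) ^ 2 / (2 * v)) ≤
      (2 + 3 / ((c - 1) / (4 * c))) ^ 3 * exp ((1 + 2 / (c - 1)) * B / (2 * c)) *
        exp (-X ^ 2 / (2 * (c * v))) := by
  have hc1 : 0 < c - 1 := by linarith
  have hc0 : 0 < c := by linarith
  have h1 := one_add_pow_three_le (ε := (c - 1) / (4 * c)) (by positivity) (r := |X - m| / √v)
  refine (mul_le_mul_of_nonneg_right h1 (exp_nonneg _)).trans ?_
  rw [mul_assoc, mul_assoc, ← Real.exp_add, ← Real.exp_add]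
  refine mul_le_mul_of_nonneg_left (Real.exp_le_exp.2 ?_) (by positivity)
  rw [div_pow, sq_abs, Real.sq_sqrt hv.le]
  set Y := X - m with hY
  have hX : X = Y + m := by rw [hY]; ring
  rw [hX]
  have h2 : (Y + m) ^ 2 ≤ (1 + c) / 2 * Y ^ 2 + (1 + 2 / (c - 1)) * (B * v) := by
    have h3 : (1 + 2 / (c - 1)) * m ^ 2 ≤ (1 + 2 / (c - 1)) * (B * v) := by gcongr
    have h4 : (1 + c) / 2 * Y ^ 2 + (1 + 2 / (c - 1)) * m ^ 2 - (Y + m) ^ 2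
        = ((c - 1) * Y - 2 * m) ^ 2 / (2 * (c - 1)) := by
      field_simp; ring
    have h5 : 0 ≤ ((c - 1) * Y - 2 * m) ^ 2 / (2 * (c - 1)) := by positivity
    linarith
  have h6 := div_le_div_of_nonneg_right h2 (by positivity : 0 ≤ 2 * (c * v))
  have h7 : ((1 + c) / 2 * Y ^ 2 + (1 + 2 / (c - 1)) * (B * v)) / (2 * (c * v))
      = (1 + 2 / (c - 1)) * B / (2 * c) + Y ^ 2 / (2 * v) - (c - 1) / (4 * c) * (Y ^ 2 / v) := by
    field_simp; ring
  rw [neg_div, neg_div]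
  linarith

lemma abs_div_le_weight {v : ℝ} (hv : 0 < v) (y : ℝ) :
    |-y / v| ≤ (1 + |y| / √v) / √v := by
  have hs : 0 < √v := Real.sqrt_pos.2 hv
  rw [abs_div, abs_neg, abs_of_pos hv]
  have : |y| / v = |y| / √v / √v := by rw [div_div, Real.mul_self_sqrt hv.le]
  rw [this]
  gcongr
  linarith

lemma abs_sq_sub_le_weight {v : ℝ} (hv : 0 < v) (y : ℝ) :
    |y ^ 2 / v ^ 2 - 1 / v| ≤ (1 + |y| / √v) ^ 2 / v := by
  have hs : 0 < √v := Real.sqrt_pos.2 hv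
  have e : (|y| / √v) ^ 2 = y ^ 2 / v := by rw [div_pow, sq_abs, Real.sq_sqrt hv.le]
  have e2 : y ^ 2 / v ^ 2 - 1 / v = ((|y| / √v) ^ 2 - 1) / v := by rw [e]; field_simp
  have h0 : 0 ≤ |y| / √v := by positivity
  rw [e2, abs_div, abs_of_pos hv]
  gcongr
  rw [abs_le]
  constructor <;> nlinarith

/-- Uniform bounds on the Gaussian density and its first two derivatives. -/
lemma exists_gauss_bound {v₀ : ℝ} (hv₀ : 0 < v₀) :
    ∃ C : ℝ, 0 ≤ C ∧ ∀ v, v₀ ≤ v → ∀ y, gauss v y ≤ C ∧ |-y / v * gauss v y| ≤ C ∧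
      |(y ^ 2 / v ^ 2 - 1 / v) * gauss v y| ≤ C := by
  set A : ℝ := (2 + 3 / (1 / 2)) ^ 3 with hA
  set D : ℝ := (√(2 * π * v₀))⁻¹ * A with hD
  refine ⟨D + 1 / √v₀ * D + 1 / v₀ * D, by positivity, fun v hv y => ?_⟩
  have hv0 : 0 < v := hv₀.trans_le hv
  have hR : 1 ≤ 1 + |y| / √v := by have : 0 ≤ |y| / √v := by positivity
                                   linarith
  have key : (1 + |y| / √v) ^ 3 * gauss v y ≤ D := by
    have h1 := one_add_pow_three_le (ε := 1 / 2) (by norm_num) (r := |y| / √v)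
    rw [div_pow (|y|), sq_abs, Real.sq_sqrt hv0.le] at h1
    unfold gauss
    have h2 : (1 + |y| / √v) ^ 3 * exp (-y ^ 2 / (2 * v)) ≤ A := by
      refine (mul_le_mul_of_nonneg_right h1 (exp_nonneg _)).trans (le_of_eq ?_)
      rw [mul_assoc, ← Real.exp_add]
      have : 1 / 2 * (y ^ 2 / v) + -y ^ 2 / (2 * v) = 0 := by field_simp; ring
      rw [this, exp_zero, mul_one]
    calc _ = (√(2 * π * v))⁻¹ * ((1 + |y| / √v) ^ 3 * exp (-y ^ 2 / (2 * v))) := by ring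
      _ ≤ _ := by rw [hD]; gcongr
  have hg := gauss_nonneg v y
  have hD0 : 0 ≤ D := by positivity
  have k0 : gauss v y ≤ D :=
    (le_mul_of_one_le_left hg (one_le_pow₀ hR)).trans key
  have k1 : (1 + |y| / √v) * gauss v y ≤ D := by
    refine le_trans ?_ key
    gcongr
    exact le_self_pow₀ hR (by norm_num)
  have k2 : (1 + |y| / √v) ^ 2 * gauss v y ≤ D := by
    refine le_trans ?_ key
    gcongr 1
    exact pow_le_pow_right₀ hR (by norm_num)
  have p1 : 0 ≤ 1 / √v₀ * D := by positivity
  have p2 : 0 ≤ 1 / v₀ * D := by positivity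
  refine ⟨by linarith, ?_, ?_⟩
  · rw [abs_mul, abs_of_nonneg hg]
    have : |-y / v| * gauss v y ≤ 1 / √v₀ * D := by
      calc _ ≤ (1 + |y| / √v) / √v * gauss v y := by gcongr; exact abs_div_le_weight hv0 y
        _ = 1 / √v * ((1 + |y| / √v) * gauss v y) := by ring
        _ ≤ _ := by gcongr
    linarith
  · rw [abs_mul, abs_of_nonneg hg]
    have : |y ^ 2 / v ^ 2 - 1 / v| * gauss v y ≤ 1 / v₀ * D := by
      calc _ ≤ (1 + |y| / √v) ^ 2 / v * gauss v y := by gcongr; exact abs_sq_sub_le_weight hv0 y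
        _ = 1 / v * ((1 + |y| / √v) ^ 2 * gauss v y) := by ring
        _ ≤ _ := by gcongr
    linarith

lemma gauss_eq_exp (v y : ℝ) : gauss v y = (√(2 * π * v))⁻¹ * exp (-(2 * v)⁻¹ * y ^ 2) := by
  unfold gauss
  congr 2
  rw [div_eq_mul_inv]
  ring

lemma integrable_gauss {v : ℝ} (hv : 0 < v) : Integrable (gauss v) := by
  have : gauss v = fun y => (√(2 * π * v))⁻¹ * exp (-(2 * v)⁻¹ * y ^ 2) :=
    funext (gauss_eq_exp v)
  rw [this]
  exact (integrable_exp_neg_mul_sq (by positivity)).const_mul _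

lemma integral_gauss {v : ℝ} (hv : 0 < v) : ∫ y, gauss v y = 1 := by
  simp_rw [gauss_eq_exp]
  rw [integral_const_mul, integral_gaussian]
  have h : π / (2 * v)⁻¹ = 2 * π * v := by field_simp
  rw [h]
  exact inv_mul_cancel₀ (Real.sqrt_pos.2 (by positivity)).ne'

lemma gauss_mul_gauss {v θ : ℝ} (hv : 0 < v) (hθ : 0 < θ) (x z : ℝ) :
    gauss v (x + z) * gauss θ z =
      gauss (v + θ) x * gauss (v * θ / (v + θ)) (z + x * θ / (v + θ)) := by
  have e1 : (√(2 * π * v))⁻¹ * (√(2 * π * θ))⁻¹ =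
      (√(2 * π * (v + θ)))⁻¹ * (√(2 * π * (v * θ / (v + θ))))⁻¹ := by
    rw [← mul_inv, ← mul_inv, ← Real.sqrt_mul (by positivity), ← Real.sqrt_mul (by positivity)]
    congr 2
    field_simp
  have e2 : -(x + z) ^ 2 / (2 * v) + -z ^ 2 / (2 * θ) = -x ^ 2 / (2 * (v + θ)) +
      -(z + x * θ / (v + θ)) ^ 2 / (2 * (v * θ / (v + θ))) := by
    field_simp
    ring
  unfold gauss
  rw [mul_mul_mul_comm, e1, ← Real.exp_add, e2, Real.exp_add]
  ring

lemma integrable_gauss_mul_gauss {v θ : ℝ} (hv : 0 < v) (hθ : 0 < θ) (x : ℝ) :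
    Integrable fun z => gauss v (x + z) * gauss θ z := by
  simp_rw [gauss_mul_gauss hv hθ]
  exact ((integrable_gauss (by positivity)).comp_add_right _).const_mul _

lemma integral_gauss_mul_gauss {v θ : ℝ} (hv : 0 < v) (hθ : 0 < θ) (x : ℝ) :
    ∫ z, gauss v (x + z) * gauss θ z = gauss (v + θ) x := by
  simp_rw [gauss_mul_gauss hv hθ]
  rw [integral_const_mul, integral_add_right_eq_self (gauss (v * θ / (v + θ))),
    integral_gauss (by positivity), mul_one]

section Series

variable {w v : ℕ → ℝ} {v₀ : ℝ}

lemma summable_mul_gauss (hw : Summable w) (hw0 : ∀ n, 0 ≤ w n) (hv₀ : 0 < v₀)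
    (hv : ∀ n, v₀ ≤ v n) (y : ℝ) : Summable fun n => w n * gauss (v n) y := by
  obtain ⟨C, -, hC⟩ := exists_gauss_bound hv₀
  exact Summable.of_nonneg_of_le (fun n => mul_nonneg (hw0 n) (gauss_nonneg _ _))
    (fun n => mul_le_mul_of_nonneg_left (hC _ (hv n) y).1 (hw0 n)) (hw.mul_right C)

lemma summable_mul_deriv_gauss (hw : Summable w) (hw0 : ∀ n, 0 ≤ w n) (hv₀ : 0 < v₀)
    (hv : ∀ n, v₀ ≤ v n) (y : ℝ) : Summable fun n => w n * (-y / v n * gauss (v n) y) := by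
  obtain ⟨C, -, hC⟩ := exists_gauss_bound hv₀
  refine Summable.of_norm_bounded (hw.mul_right C) fun n => ?_
  rw [norm_mul, Real.norm_of_nonneg (hw0 n)]
  exact mul_le_mul_of_nonneg_left (hC _ (hv n) y).2.1 (hw0 n)

lemma summable_mul_deriv2_gauss (hw : Summable w) (hw0 : ∀ n, 0 ≤ w n) (hv₀ : 0 < v₀)
    (hv : ∀ n, v₀ ≤ v n) (y : ℝ) :
    Summable fun n => w n * ((y ^ 2 / v n ^ 2 - 1 / v n) * gauss (v n) y) := by
  obtain ⟨C, -, hC⟩ := exists_gauss_bound hv₀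
  refine Summable.of_norm_bounded (hw.mul_right C) fun n => ?_
  rw [norm_mul, Real.norm_of_nonneg (hw0 n)]
  exact mul_le_mul_of_nonneg_left (hC _ (hv n) y).2.2 (hw0 n)

lemma hasDerivAt_tsum_gauss (hw : Summable w) (hw0 : ∀ n, 0 ≤ w n) (hv₀ : 0 < v₀)
    (hv : ∀ n, v₀ ≤ v n) (m x : ℝ) :
    HasDerivAt (fun x => ∑' n, w n * gauss (v n) (x - m))
      (∑' n, w n * (-(x - m) / v n * gauss (v n) (x - m))) x := by
  obtain ⟨C, -, hC⟩ := exists_gauss_bound hv₀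
  refine hasDerivAt_tsum (hw.mul_right C)
    (fun n y => (hasDerivAt_gauss (hv₀.trans_le (hv n)) m y).const_mul (w n)) (fun n y => ?_)
    (summable_mul_gauss hw hw0 hv₀ hv (0 - m)) x
  rw [norm_mul, Real.norm_of_nonneg (hw0 n)]
  exact mul_le_mul_of_nonneg_left (hC _ (hv n) _).2.1 (hw0 n)

lemma hasDerivAt_tsum_deriv_gauss (hw : Summable w) (hw0 : ∀ n, 0 ≤ w n) (hv₀ : 0 < v₀)
    (hv : ∀ n, v₀ ≤ v n) (m x : ℝ) :
    HasDerivAt (fun x => ∑' n, w n * (-(x - m) / v n * gauss (v n) (x - m)))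
      (∑' n, w n * (((x - m) ^ 2 / v n ^ 2 - 1 / v n) * gauss (v n) (x - m))) x := by
  obtain ⟨C, -, hC⟩ := exists_gauss_bound hv₀
  refine hasDerivAt_tsum (hw.mul_right C)
    (fun n y => (hasDerivAt_deriv_gauss (hv₀.trans_le (hv n)) m y).const_mul (w n)) (fun n y => ?_)
    (summable_mul_deriv_gauss hw hw0 hv₀ hv (0 - m)) x
  rw [norm_mul, Real.norm_of_nonneg (hw0 n)]
  exact mul_le_mul_of_nonneg_left (hC _ (hv n) _).2.2 (hw0 n)

lemma integrable_tsum_gauss_mul_gauss (hw : Summable w) (hw0 : ∀ n, 0 ≤ w n) (hv₀ : 0 < v₀)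
    (hv : ∀ n, v₀ ≤ v n) {θ : ℝ} (hθ : 0 < θ) (m x : ℝ) :
    Integrable fun z => (∑' n, w n * gauss (v n) (x + z - m)) * gauss θ z := by
  obtain ⟨C, -, hC⟩ := exists_gauss_bound hv₀
  have hd : Differentiable ℝ fun x => ∑' n, w n * gauss (v n) (x - m) :=
    fun x => (hasDerivAt_tsum_gauss hw hw0 hv₀ hv m x).differentiableAt
  refine (integrable_gauss hθ).bdd_mul (c := ∑' n, w n * C)
    (hd.continuous.comp (continuous_const.add continuous_id)).aestronglyMeasurable
    (.of_forall fun z => ?_)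
  rw [Real.norm_of_nonneg (tsum_nonneg fun n => mul_nonneg (hw0 n) (gauss_nonneg _ _))]
  exact (summable_mul_gauss hw hw0 hv₀ hv _).tsum_le_tsum
    (fun n => mul_le_mul_of_nonneg_left (hC _ (hv n) _).1 (hw0 n)) (hw.mul_right C)

lemma integral_tsum_gauss_mul_gauss (hw : Summable w) (hw0 : ∀ n, 0 ≤ w n) (hv₀ : 0 < v₀)
    (hv : ∀ n, v₀ ≤ v n) {θ : ℝ} (hθ : 0 < θ) (m x : ℝ) :
    ∫ z, (∑' n, w n * gauss (v n) (x + z - m)) * gauss θ z =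
      ∑' n, w n * gauss (v n + θ) (x - m) := by
  have hF : ∀ n z, w n * gauss (v n) (x + z - m) * gauss θ z =
      w n * (gauss (v n) (x - m + z) * gauss θ z) := fun n z => by
    rw [mul_assoc, add_sub_right_comm]
  have hi : ∀ n, ∫ z, w n * gauss (v n) (x + z - m) * gauss θ z =
      w n * gauss (v n + θ) (x - m) := fun n => by
    simp_rw [hF]
    rw [integral_const_mul, integral_gauss_mul_gauss (hv₀.trans_le (hv n)) hθ]
  have h := hasSum_integral_of_summable_integral_norm (μ := volume)
    (F := fun n z => w n * gauss (v n) (x + z - m) * gauss θ z)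
    (fun n => by
      simp_rw [hF]
      exact (integrable_gauss_mul_gauss (hv₀.trans_le (hv n)) hθ _).const_mul _)
    (by
      have : ∀ n z, ‖w n * gauss (v n) (x + z - m) * gauss θ z‖ =
          w n * gauss (v n) (x + z - m) * gauss θ z := fun n z =>
        Real.norm_of_nonneg
          (mul_nonneg (mul_nonneg (hw0 n) (gauss_nonneg _ _)) (gauss_nonneg _ _))
      simp_rw [this, hi]
      exact summable_mul_gauss hw hw0 hv₀ (fun n => (hv n).trans (by linarith)) _)
  simp_rw [hi, tsum_mul_right] at h
  exact h.tsum_eq.symm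

end Series

lemma summable_pow_div_factorial_deriv (l b : ℝ) :
    Summable fun n : ℕ => n * (b ^ (n - 1) * l) / n.factorial := by
  refine (summable_nat_add_iff 1).1 (((summable_pow_div_factorial b).mul_left l).congr fun n => ?_)
  rw [Nat.factorial_succ]
  have : (n.factorial : ℝ) ≠ 0 := by positivity
  push_cast
  field_simp

lemma hasDerivAt_time_series {α θ l s : ℝ} (hα : 0 < α) (hθ : 0 ≤ θ) (hl : 0 ≤ l) (hs : 0 < s)
    (μ x : ℝ) :
    HasDerivAt
      (fun s => ∑' n : ℕ, (l * s) ^ n / n.factorial * gauss (α * s + n * θ) (x - μ * s))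
      (l * ∑' n : ℕ, (l * s) ^ n / n.factorial * gauss (α * s + n * θ + θ) (x - μ * s)
        + α / 2 * ∑' n : ℕ, (l * s) ^ n / n.factorial *
          (((x - μ * s) ^ 2 / (α * s + n * θ) ^ 2 - 1 / (α * s + n * θ)) *
            gauss (α * s + n * θ) (x - μ * s))
        - μ * ∑' n : ℕ, (l * s) ^ n / n.factorial *
          (-(x - μ * s) / (α * s + n * θ) * gauss (α * s + n * θ) (x - μ * s))) s := by
  obtain ⟨C, hC0, hC⟩ := exists_gauss_bound (v₀ := α * (s / 2)) (by positivity)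
  have hvar : ∀ r ∈ Set.Ioo (s / 2) (2 * s), ∀ n : ℕ, α * (s / 2) ≤ α * r + n * θ := by
    intro r hr n
    have h1 : α * (s / 2) ≤ α * r := by gcongr; exact hr.1.le
    have h2 : 0 ≤ n * θ := by positivity
    linarith
  have hmem : s ∈ Set.Ioo (s / 2) (2 * s) := ⟨by linarith, by linarith⟩
  have hw : Summable fun n : ℕ => (l * s) ^ n / (n.factorial : ℝ) :=
    summable_pow_div_factorial _
  have hw0 : ∀ n : ℕ, 0 ≤ (l * s) ^ n / (n.factorial : ℝ) := fun n => by positivity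
  have hv₀ : 0 < α * (s / 2) := by positivity
  have s0 := summable_mul_gauss hw hw0 hv₀ (hvar s hmem) (x - μ * s)
  have s0' := summable_mul_gauss (v := fun n : ℕ => α * s + n * θ + θ) hw hw0 hv₀
    (fun n => (hvar s hmem n).trans (by linarith)) (x - μ * s)
  have s1 := summable_mul_deriv_gauss hw hw0 hv₀ (hvar s hmem) (x - μ * s)
  have s2 := summable_mul_deriv2_gauss hw hw0 hv₀ (hvar s hmem) (x - μ * s)
  have hD := hasDerivAt_tsum_of_isPreconnected (𝕜 := ℝ)
    (u := fun n : ℕ => n * ((l * (2 * s)) ^ (n - 1) * l) / n.factorial * C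
      + (l * (2 * s)) ^ n / n.factorial * (α / 2 * C + |μ| * C))
    (g := fun (n : ℕ) s => (l * s) ^ n / n.factorial * gauss (α * s + n * θ) (x - μ * s))
    (g' := fun (n : ℕ) s => n * ((l * s) ^ (n - 1) * l) / n.factorial *
        gauss (α * s + n * θ) (x - μ * s)
      + (l * s) ^ n / n.factorial *
        (α / 2 * (((x - μ * s) ^ 2 / (α * s + n * θ) ^ 2 - 1 / (α * s + n * θ)) *
            gauss (α * s + n * θ) (x - μ * s))
          + -μ * (-(x - μ * s) / (α * s + n * θ) * gauss (α * s + n * θ) (x - μ * s))))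
    (((summable_pow_div_factorial_deriv _ _).mul_right C).add
      ((summable_pow_div_factorial _).mul_right _))
    isOpen_Ioo isPreconnected_Ioo ?_ ?_ hmem s0 hmem
  · refine hD.congr_deriv ?_
    have hA : HasSum (fun n : ℕ => n * ((l * s) ^ (n - 1) * l) / (n.factorial : ℝ) *
        gauss (α * s + n * θ) (x - μ * s))
        (l * ∑' n : ℕ, (l * s) ^ n / n.factorial * gauss (α * s + n * θ + θ) (x - μ * s)) := by
      have h := s0'.hasSum.mul_left l
      rw [← hasSum_nat_add_iff' 1]
      simp only [Finset.range_one, Finset.sum_singleton, Nat.cast_zero, zero_mul, zero_div,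
        sub_zero]
      refine h.congr_fun ?_
      intro n
      rw [Nat.factorial_succ]
      have : (n.factorial : ℝ) ≠ 0 := by positivity
      push_cast
      rw [show α * s + (n + 1 : ℝ) * θ = α * s + n * θ + θ by ring]
      field_simp
    have hB := (s2.hasSum.mul_left (α / 2)).add (s1.hasSum.mul_left (-μ))
    rw [((hA.add hB).congr_fun fun n => ?_).tsum_eq]
    · ring
    · ring
  · intro n r hr
    have hpos : 0 < α * r + n * θ := hv₀.trans_le (hvar r hr n)
    have h1 : HasDerivAt (fun s => α * s + n * θ) α r := by
      simpa using ((hasDerivAt_id r).const_mul α).add_const (n * θ)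
    have h2 : HasDerivAt (fun s => x - μ * s) (-μ) r := by
      simpa using ((hasDerivAt_id r).const_mul μ).const_sub x
    have h3 : HasDerivAt (fun s => l * s) l r := by
      simpa using (hasDerivAt_id r).const_mul l
    refine (((h3.fun_pow n).div_const _).fun_mul
      (hasDerivAt_gauss_comp hpos h1 h2)).congr_deriv ?_
    ring
  · intro n r hr
    have hr0 : 0 < r := (half_pos hs).trans hr.1
    obtain ⟨b0, b1, b2⟩ := hC _ (hvar r hr n) (x - μ * r)
    have hp : ∀ k : ℕ, (l * r) ^ k ≤ (l * (2 * s)) ^ k := fun k => by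
      gcongr; exact hr.2.le
    refine (norm_add_le _ _).trans (add_le_add ?_ ?_)
    · rw [norm_mul, Real.norm_of_nonneg (gauss_nonneg _ _), Real.norm_of_nonneg (by positivity)]
      have := hp (n - 1)
      gcongr
      exact gauss_nonneg _ _
    · rw [norm_mul, Real.norm_of_nonneg (by positivity)]
      have := hp n
      gcongr
      refine (norm_add_le _ _).trans (add_le_add ?_ ?_)
      · rw [norm_mul, Real.norm_of_nonneg (by positivity)]
        gcongr
        exact b2
      · rw [norm_mul, norm_neg]
        gcongr
        exacts [le_rfl, b1]

lemma exists_shifted_gauss_bound {M c τ μ₀ : ℝ} (hM : 1 ≤ M) (hc : 1 < c) :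
    ∃ K : ℝ, 0 < K ∧ ∀ μ s v ρ X : ℝ, 0 ≤ μ → μ ≤ μ₀ → 0 < s → s ≤ τ → s ≤ ρ →
      M⁻¹ * ρ ≤ v → v ≤ M * ρ →
      (1 + |X - μ * s| / √v) ^ 3 * gauss v (X - μ * s) ≤ K * gauss (c * M * ρ) X ∧
      |X| ≤ K * (√v * (1 + |X - μ * s| / √v)) := by
  have hM0 : 0 < M := by linarith
  have hc0 : 0 < c := by linarith
  have hc1 : 0 < c - 1 := by linarith
  set B : ℝ := μ₀ ^ 2 * τ * M with hB
  set A : ℝ := (2 + 3 / ((c - 1) / (4 * c))) ^ 3 * exp ((1 + 2 / (c - 1)) * B / (2 * c)) with hA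
  have hA0 : 0 < A := by positivity
  refine ⟨√(c * M ^ 2) * A + (1 + √B), by positivity,
    fun μ s v ρ X hμ hμ' hs hsτ hsρ hvl hvu => ?_⟩
  have hρ : 0 < ρ := by linarith
  have hv : 0 < v := lt_of_lt_of_le (by positivity) hvl
  have hρv : ρ ≤ M * v := by rwa [inv_mul_le_iff₀ hM0] at hvl
  have hB0 : 0 ≤ B := by have : 0 < τ := by linarith
                         positivity
  have hm : (μ * s) ^ 2 ≤ B * v := by
    calc (μ * s) ^ 2 = μ ^ 2 * (s * s) := by ring
      _ ≤ μ₀ ^ 2 * (τ * (M * v)) := by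
        gcongr
        · linarith
        · linarith
      _ = B * v := by rw [hB]; ring
  constructor
  · have h1 := weighted_exp_le (X := X) hc hv hm
    have h2 : exp (-X ^ 2 / (2 * (c * v))) ≤ exp (-X ^ 2 / (2 * (c * M * ρ))) := by
      rw [Real.exp_le_exp, neg_div, neg_div, neg_le_neg_iff]
      have : c * v ≤ c * M * ρ := by rw [mul_assoc]; gcongr
      gcongr
    have h3 : (√(2 * π * v))⁻¹ ≤ √(c * M ^ 2) * (√(2 * π * (c * M * ρ)))⁻¹ := by
      rw [← div_eq_mul_inv, inv_le_comm₀ (by positivity) (by positivity), inv_div,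
        div_le_iff₀ (by positivity), ← Real.sqrt_mul (by positivity)]
      apply Real.sqrt_le_sqrt
      calc 2 * π * (c * M * ρ) ≤ 2 * π * (c * M * (M * v)) := by gcongr
        _ = 2 * π * v * (c * M ^ 2) := by ring
    have hg := gauss_nonneg (c * M * ρ) X
    calc _ = (√(2 * π * v))⁻¹ *
          ((1 + |X - μ * s| / √v) ^ 3 * exp (-(X - μ * s) ^ 2 / (2 * v))) := by
            unfold gauss; ring
      _ ≤ (√(c * M ^ 2) * (√(2 * π * (c * M * ρ)))⁻¹) *
          (A * exp (-X ^ 2 / (2 * (c * M * ρ)))) := by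
            exact mul_le_mul h3 (h1.trans (by gcongr)) (by positivity) (by positivity)
      _ = √(c * M ^ 2) * A * gauss (c * M * ρ) X := by unfold gauss; ring
      _ ≤ _ := by gcongr; linarith [Real.sqrt_nonneg B]
  · have hsv : 0 < √v := Real.sqrt_pos.2 hv
    have h1 : μ * s ≤ √B * √v := by
      rw [← Real.sqrt_mul hB0]
      exact Real.le_sqrt_of_sq_le hm
    have h2 : |X| ≤ |X - μ * s| + μ * s := by
      have := abs_add_le (X - μ * s) (μ * s)
      rwa [sub_add_cancel, abs_of_nonneg (by positivity : 0 ≤ μ * s)] at this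
    have h3 : √v * (1 + |X - μ * s| / √v) = √v + |X - μ * s| := by field_simp
    rw [h3]
    have h4 : 0 ≤ √(c * M ^ 2) * A := by positivity
    have h5 := Real.sqrt_nonneg B
    nlinarith [abs_nonneg (X - μ * s), mul_nonneg h4 (by positivity : 0 ≤ √v + |X - μ * s|),
      mul_nonneg h5 (abs_nonneg (X - μ * s))]

lemma abs_tsum_le_const_mul_tsum {f F : ℕ → ℝ} {D : ℝ} (hF : Summable F)
    (h : ∀ n, |f n| ≤ D * F n) : |∑' n, f n| ≤ D * ∑' n, F n := by
  rw [← tsum_mul_left]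
  rw [← Real.norm_eq_abs]
  exact tsum_of_norm_bounded (hF.mul_left D).hasSum h

/-- Bounds on the Gaussian series and its space derivatives by the centered series. -/
lemma exists_series_bound {M c τ μ₀ : ℝ} (hM : 1 ≤ M) (hc : 1 < c) (hτ : 0 < τ) :
    ∃ D : ℝ, 0 < D ∧ ∀ α θ l s μ X : ℝ, M⁻¹ ≤ α → α ≤ M → M⁻¹ ≤ θ → θ ≤ M → 0 ≤ l → l ≤ M →
      0 < s → s ≤ τ → 0 ≤ μ → μ ≤ μ₀ →
      |∑' n : ℕ, (l * s) ^ n / n.factorial * gauss (α * s + n * θ) (X - μ * s)| ≤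
        D / √s * ∑' n : ℕ, (c * M * s) ^ n / n.factorial * gauss (c * M * s + n * (c * M)) X ∧
      |∑' n : ℕ, (l * s) ^ n / n.factorial *
          (-(X - μ * s) / (α * s + n * θ) * gauss (α * s + n * θ) (X - μ * s))| ≤
        D / √s * ∑' n : ℕ, (c * M * s) ^ n / n.factorial * gauss (c * M * s + n * (c * M)) X ∧
      |X| * |∑' n : ℕ, (l * s) ^ n / n.factorial *
          (((X - μ * s) ^ 2 / (α * s + n * θ) ^ 2 - 1 / (α * s + n * θ)) *
            gauss (α * s + n * θ) (X - μ * s))| ≤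
        D / √s * ∑' n : ℕ, (c * M * s) ^ n / n.factorial * gauss (c * M * s + n * (c * M)) X ∧
      |X| * |∑' n : ℕ, (l * s) ^ n / n.factorial * gauss (α * s + n * θ + θ) (X - μ * s)| ≤
        D * ∑' n : ℕ, (c * M * s) ^ n / n.factorial *
          gauss (c * M * s + n * (c * M) + c * M) X := by
  obtain ⟨K, hK, hKb⟩ := exists_shifted_gauss_bound (τ := τ) (μ₀ := μ₀) hM hc
  have hM0 : 0 < M := by linarith
  have hc0 : 0 < c := by linarith
  have hc1 : 0 < c - 1 := by linarith
  set Q : ℝ := 1 + M * τ + M + M / (c - 1) with hQ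
  refine ⟨K * √τ + K * √M + K * K * √M + K * K * Q, by positivity, ?_⟩
  intro α θ l s μ X hα hα' hθ hθ' hl hl' hs hsτ hμ hμ'
  set D : ℝ := K * √τ + K * √M + K * K * √M + K * K * Q with hD
  have p1 : 0 ≤ K * √τ := by positivity
  have p2 : 0 ≤ K * √M := by positivity
  have p3 : 0 ≤ K * K * √M := by positivity
  have p4 : 0 ≤ K * K * Q := by positivity
  have hs' : 0 < √s := Real.sqrt_pos.2 hs
  have hw0 : ∀ n : ℕ, 0 ≤ (l * s) ^ n / (n.factorial : ℝ) := fun n => by positivity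
  have hwle : ∀ n : ℕ, (l * s) ^ n / (n.factorial : ℝ) ≤ (c * M * s) ^ n / n.factorial :=
    fun n => by
      have : l ≤ c * M := by nlinarith
      gcongr
  have hb0 : ∀ n : ℕ, 0 ≤ (c * M * s) ^ n / (n.factorial : ℝ) := fun n => by positivity
  have hbs : Summable fun n : ℕ => (c * M * s) ^ n / (n.factorial : ℝ) :=
    summable_pow_div_factorial _
  have hcMs : 0 < c * M * s := by positivity
  have hS := summable_mul_gauss (v := fun n : ℕ => c * M * s + n * (c * M)) hbs hb0 hcMs
    (fun n => by have : 0 ≤ (n : ℝ) * (c * M) := by positivity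
                 linarith) X
  have hS' := summable_mul_gauss (v := fun n : ℕ => c * M * s + n * (c * M) + c * M) hbs hb0 hcMs
    (fun n => by have : 0 ≤ (n : ℝ) * (c * M) := by positivity
                 have : 0 < c * M := by positivity
                 linarith) X
  have hvl : ∀ n : ℕ, M⁻¹ * (s + n) ≤ α * s + n * θ := fun n => by
    have : M⁻¹ * s ≤ α * s := by gcongr
    have : n * M⁻¹ ≤ n * θ := by gcongr
    linarith
  have hvu : ∀ n : ℕ, α * s + n * θ ≤ M * (s + n) := fun n => by
    have : α * s ≤ M * s := by gcongr
    have : n * θ ≤ n * M := by gcongr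
    linarith
  have hv0 : ∀ n : ℕ, 0 < α * s + n * θ := fun n => lt_of_lt_of_le (by positivity) (hvl n)
  have hinv : ∀ n : ℕ, 1 / √(α * s + n * θ) ≤ √M / √s := fun n => by
    rw [div_le_div_iff₀ (Real.sqrt_pos.2 (hv0 n)) hs', one_mul, ← Real.sqrt_mul hM0.le]
    apply Real.sqrt_le_sqrt
    have h1 := hvl n
    rw [inv_mul_le_iff₀ hM0] at h1
    have : (0 : ℝ) ≤ n := n.cast_nonneg
    linarith
  have hKn := fun n : ℕ => hKb μ s (α * s + n * θ) (s + n) X hμ hμ' hs hsτ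
    (by have : (0 : ℝ) ≤ n := n.cast_nonneg
        linarith) (hvl n) (hvu n)
  have hWn : ∀ n : ℕ, c * M * (s + n) = c * M * s + n * (c * M) := fun n => by ring
  simp_rw [hWn] at hKn
  have hR1 : ∀ n : ℕ, 1 ≤ 1 + |X - μ * s| / √(α * s + n * θ) := fun n => by
    have : 0 ≤ |X - μ * s| / √(α * s + n * θ) := by positivity
    linarith
  refine ⟨?_, ?_, ?_, ?_⟩
  · refine abs_tsum_le_const_mul_tsum hS fun n => ?_
    have hg := gauss_nonneg (α * s + n * θ) (X - μ * s)
    have hgb := gauss_nonneg (c * M * s + n * (c * M)) X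
    have h1 : gauss (α * s + n * θ) (X - μ * s) ≤ D / √s * gauss (c * M * s + n * (c * M)) X := by
      have h2 : K ≤ D / √s := by
        rw [le_div_iff₀ hs']
        have : K * √s ≤ K * √τ := by gcongr
        linarith
      calc _ ≤ _ := le_mul_of_one_le_left hg (one_le_pow₀ (n := 3) (hR1 n))
        _ ≤ _ := (hKn n).1
        _ ≤ _ := by gcongr
    rw [abs_of_nonneg (mul_nonneg (hw0 n) hg)]
    calc _ ≤ (c * M * s) ^ n / n.factorial * (D / √s * gauss (c * M * s + n * (c * M)) X) :=
          mul_le_mul (hwle n) h1 hg (hb0 n)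
      _ = _ := by ring
  · refine abs_tsum_le_const_mul_tsum hS fun n => ?_
    have hg := gauss_nonneg (α * s + n * θ) (X - μ * s)
    have hgb := gauss_nonneg (c * M * s + n * (c * M)) X
    have h1 : |-(X - μ * s) / (α * s + n * θ) * gauss (α * s + n * θ) (X - μ * s)| ≤
        D / √s * gauss (c * M * s + n * (c * M)) X := by
      rw [abs_mul, abs_of_nonneg hg]
      calc _ ≤ (1 + |X - μ * s| / √(α * s + n * θ)) / √(α * s + n * θ) *
            gauss (α * s + n * θ) (X - μ * s) := by
              gcongr; exact abs_div_le_weight (hv0 n) _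
        _ = 1 / √(α * s + n * θ) * ((1 + |X - μ * s| / √(α * s + n * θ)) *
            gauss (α * s + n * θ) (X - μ * s)) := by ring
        _ ≤ √M / √s * ((1 + |X - μ * s| / √(α * s + n * θ)) ^ 3 *
            gauss (α * s + n * θ) (X - μ * s)) := by
              refine mul_le_mul (hinv n) ?_ (by positivity) (by positivity)
              exact mul_le_mul_of_nonneg_right (le_self_pow₀ (hR1 n) (by norm_num)) hg
        _ ≤ √M / √s * (K * gauss (c * M * s + n * (c * M)) X) :=
              mul_le_mul_of_nonneg_left (hKn n).1 (by positivity)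
        _ = K * √M / √s * gauss (c * M * s + n * (c * M)) X := by ring
        _ ≤ _ := by gcongr; linarith
    rw [abs_mul, abs_of_nonneg (hw0 n)]
    calc _ ≤ (c * M * s) ^ n / n.factorial * (D / √s * gauss (c * M * s + n * (c * M)) X) :=
          mul_le_mul (hwle n) h1 (abs_nonneg _) (hb0 n)
      _ = _ := by ring
  · rw [← abs_mul, ← tsum_mul_left]
    refine abs_tsum_le_const_mul_tsum hS fun n => ?_
    have hg := gauss_nonneg (α * s + n * θ) (X - μ * s)
    have hgb := gauss_nonneg (c * M * s + n * (c * M)) X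
    have hsv : 0 < √(α * s + n * θ) := Real.sqrt_pos.2 (hv0 n)
    have h1 : |X| * |((X - μ * s) ^ 2 / (α * s + n * θ) ^ 2 - 1 / (α * s + n * θ)) *
          gauss (α * s + n * θ) (X - μ * s)| ≤
        D / √s * gauss (c * M * s + n * (c * M)) X := by
      rw [abs_mul, abs_of_nonneg hg]
      calc _ ≤ K * (√(α * s + n * θ) * (1 + |X - μ * s| / √(α * s + n * θ))) *
            ((1 + |X - μ * s| / √(α * s + n * θ)) ^ 2 / (α * s + n * θ) *
            gauss (α * s + n * θ) (X - μ * s)) := by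
              gcongr
              · exact (hKn n).2
              · exact abs_sq_sub_le_weight (hv0 n) _
        _ = K * (√(α * s + n * θ) / (α * s + n * θ)) *
            ((1 + |X - μ * s| / √(α * s + n * θ)) ^ 3 *
            gauss (α * s + n * θ) (X - μ * s)) := by ring
        _ = K * (1 / √(α * s + n * θ)) * ((1 + |X - μ * s| / √(α * s + n * θ)) ^ 3 *
            gauss (α * s + n * θ) (X - μ * s)) := by rw [Real.sqrt_div_self']
        _ ≤ K * (√M / √s) * (K * gauss (c * M * s + n * (c * M)) X) := by
              refine mul_le_mul ?_ (hKn n).1 (by positivity) (by positivity)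
              exact mul_le_mul_of_nonneg_left (hinv n) hK.le
        _ = K * K * √M / √s * gauss (c * M * s + n * (c * M)) X := by ring
        _ ≤ _ := by gcongr; linarith
    rw [abs_mul, abs_mul, abs_of_nonneg (hw0 n)]
    calc _ = (l * s) ^ n / n.factorial * (|X| *
          |((X - μ * s) ^ 2 / (α * s + n * θ) ^ 2 - 1 / (α * s + n * θ)) *
          gauss (α * s + n * θ) (X - μ * s)|) := by ring
      _ ≤ (c * M * s) ^ n / n.factorial * (D / √s * gauss (c * M * s + n * (c * M)) X) :=
          mul_le_mul (hwle n) h1 (by positivity) (hb0 n)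
      _ = _ := by ring
  · rw [← abs_mul, ← tsum_mul_left]
    refine abs_tsum_le_const_mul_tsum hS' fun n => ?_
    have hg := gauss_nonneg (α * s + n * θ + θ) (X - μ * s)
    have hgb := gauss_nonneg (c * M * s + n * (c * M) + c * M) X
    have hn : (0 : ℝ) ≤ n := n.cast_nonneg
    have hKn' := hKb μ s (α * s + n * θ + θ) (s + n + 1) X hμ hμ' hs hsτ (by linarith)
      (by linarith [hvl n]) (by linarith [hvu n])
    rw [show c * M * (s + n + 1) = c * M * s + n * (c * M) + c * M by ring] at hKn'
    have hR : 1 ≤ 1 + |X - μ * s| / √(α * s + n * θ + θ) := by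
      have : 0 ≤ |X - μ * s| / √(α * s + n * θ + θ) := by positivity
      linarith
    have h1 : |X| * gauss (α * s + n * θ + θ) (X - μ * s) ≤
        K * K * √(α * s + n * θ + θ) * gauss (c * M * s + n * (c * M) + c * M) X := by
      calc _ ≤ K * (√(α * s + n * θ + θ) * (1 + |X - μ * s| / √(α * s + n * θ + θ))) *
            gauss (α * s + n * θ + θ) (X - μ * s) := by gcongr; exact hKn'.2
        _ = K * √(α * s + n * θ + θ) * ((1 + |X - μ * s| / √(α * s + n * θ + θ)) *
            gauss (α * s + n * θ + θ) (X - μ * s)) := by ring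
        _ ≤ K * √(α * s + n * θ + θ) * ((1 + |X - μ * s| / √(α * s + n * θ + θ)) ^ 3 *
            gauss (α * s + n * θ + θ) (X - μ * s)) := by
              gcongr; exact le_self_pow₀ hR (by norm_num)
        _ ≤ K * √(α * s + n * θ + θ) * (K * gauss (c * M * s + n * (c * M) + c * M) X) :=
              mul_le_mul_of_nonneg_left hKn'.1 (by positivity)
        _ = _ := by ring
    have h2 : √(α * s + n * θ + θ) ≤ Q * c ^ n := by
      have h3 : √(α * s + n * θ + θ) ≤ 1 + M * (τ + n + 1) := by
        rw [Real.sqrt_le_iff]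
        have h4 : α * s + n * θ + θ ≤ M * (τ + n + 1) := by
          have := hvu n
          have : M * s ≤ M * τ := by gcongr
          linarith
        have h5 : 0 ≤ M * (τ + n + 1) := by positivity
        exact ⟨by linarith, by nlinarith⟩
      have h6 : 1 + n * (c - 1) ≤ c ^ n := by
        have := one_add_mul_le_pow (a := c - 1) (by linarith) n
        simpa using this
      have h7 : 1 + M * (τ + n + 1) ≤ Q * (1 + n * (c - 1)) := by
        have : Q * (1 + n * (c - 1)) =
            1 + M * (τ + n + 1) + (1 + M * τ + M) * (n * (c - 1)) + M / (c - 1) := by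
          rw [hQ]; field_simp; ring
        rw [this]
        have : 0 ≤ (1 + M * τ + M) * (n * (c - 1)) := by positivity
        have : 0 ≤ M / (c - 1) := by positivity
        linarith
      exact h3.trans (h7.trans (by gcongr))
    have h8 : (l * s) ^ n / n.factorial * c ^ n ≤ (c * M * s) ^ n / (n.factorial : ℝ) := by
      rw [div_mul_eq_mul_div, ← mul_pow]
      have : l * s * c ≤ c * M * s := by
        calc l * s * c ≤ M * s * c := by gcongr
          _ = c * M * s := by ring
      gcongr
    rw [abs_mul, abs_of_nonneg (mul_nonneg (hw0 n) hg)]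
    calc _ = (l * s) ^ n / n.factorial * (|X| * gauss (α * s + n * θ + θ) (X - μ * s)) := by ring
      _ ≤ (l * s) ^ n / n.factorial * (K * K * (Q * c ^ n) *
            gauss (c * M * s + n * (c * M) + c * M) X) := by
          refine mul_le_mul_of_nonneg_left (h1.trans ?_) (hw0 n)
          gcongr
      _ = K * K * Q * ((l * s) ^ n / n.factorial * c ^ n *
            gauss (c * M * s + n * (c * M) + c * M) X) := by ring
      _ ≤ D * ((c * M * s) ^ n / n.factorial * gauss (c * M * s + n * (c * M) + c * M) X) := by
          gcongr
          linarith


/-- Since the parametrix solves the frozen equation, `L` acts on it through the coefficient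
differences only. -/
lemma Lop_p0 {a lam : ℝ → ℝ} {δ x y t T α θ l s μ X : ℝ} (hα0 : 0 < α) (hθ0 : 0 < θ) (hl0 : 0 ≤ l)
    (hs0 : 0 < s) (hα : a y = α) (hθ : δ ^ 2 = θ) (hl : lam y = l) (hs : T - t = s)
    (hμ : α / 2 + l * (exp (θ / 2) - 1) = μ) (hX : x - y = X) :
    Lop a lam δ (fun s w => p0 a lam δ s w T y) t x = exp (-(l * s)) *
      ((a x - α) / 2 * (∑' n : ℕ, (l * s) ^ n / n.factorial *
            (((X - μ * s) ^ 2 / (α * s + n * θ) ^ 2 - 1 / (α * s + n * θ)) *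
              gauss (α * s + n * θ) (X - μ * s))
          - ∑' n : ℕ, (l * s) ^ n / n.factorial *
            (-(X - μ * s) / (α * s + n * θ) * gauss (α * s + n * θ) (X - μ * s)))
        - (lam x - l) * (exp (θ / 2) - 1) * ∑' n : ℕ, (l * s) ^ n / n.factorial *
            (-(X - μ * s) / (α * s + n * θ) * gauss (α * s + n * θ) (X - μ * s))
        + (lam x - l) *
          (∑' n : ℕ, (l * s) ^ n / n.factorial * gauss (α * s + n * θ + θ) (X - μ * s)
            - ∑' n : ℕ, (l * s) ^ n / n.factorial * gauss (α * s + n * θ) (X - μ * s))) := by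
  have hw : Summable fun n : ℕ => (l * s) ^ n / (n.factorial : ℝ) :=
    summable_pow_div_factorial _
  have hw0 : ∀ n : ℕ, 0 ≤ (l * s) ^ n / (n.factorial : ℝ) := fun n => by positivity
  have hv₀ : 0 < α * s := by positivity
  have hv : ∀ n : ℕ, α * s ≤ α * s + n * θ := fun n => by
    have : 0 ≤ n * θ := by positivity
    linarith
  have hm : ∀ w, w - y - μ * s = w - (y + μ * s) := fun w => by ring
  have hu : (fun w => p0 a lam δ t w T y) = fun w => exp (-(l * s)) *
      ∑' n : ℕ, (l * s) ^ n / n.factorial * gauss (α * s + n * θ) (w - (y + μ * s)) := by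
    funext w
    unfold p0 G Gn
    rw [hα, hθ, hl, hs, hμ, ← hm]
    rfl
  have hd1 : deriv (fun w => p0 a lam δ t w T y) = fun w => exp (-(l * s)) *
      ∑' n : ℕ, (l * s) ^ n / n.factorial * (-(w - (y + μ * s)) / (α * s + n * θ) *
        gauss (α * s + n * θ) (w - (y + μ * s))) := by
    rw [hu]
    funext w
    exact ((hasDerivAt_tsum_gauss hw hw0 hv₀ hv _ w).const_mul _).deriv
  have hd2 : deriv (deriv (fun w => p0 a lam δ t w T y)) x = exp (-(l * s)) *
      ∑' n : ℕ, (l * s) ^ n / n.factorial *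
        (((x - (y + μ * s)) ^ 2 / (α * s + n * θ) ^ 2 - 1 / (α * s + n * θ)) *
        gauss (α * s + n * θ) (x - (y + μ * s))) := by
    rw [hd1]
    exact ((hasDerivAt_tsum_deriv_gauss hw hw0 hv₀ hv _ x).const_mul _).deriv
  have hXm : x - (y + μ * s) = X - μ * s := by rw [← hX]; ring
  have hdt : deriv (fun r => p0 a lam δ r x T y) t = -(-l * exp (-(l * s)) *
      (∑' n : ℕ, (l * s) ^ n / n.factorial * gauss (α * s + n * θ) (X - μ * s)) +
      exp (-(l * s)) *
      (l * ∑' n : ℕ, (l * s) ^ n / n.factorial * gauss (α * s + n * θ + θ) (X - μ * s)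
        + α / 2 * ∑' n : ℕ, (l * s) ^ n / n.factorial *
          (((X - μ * s) ^ 2 / (α * s + n * θ) ^ 2 - 1 / (α * s + n * θ)) *
            gauss (α * s + n * θ) (X - μ * s))
        - μ * ∑' n : ℕ, (l * s) ^ n / n.factorial *
          (-(X - μ * s) / (α * s + n * θ) * gauss (α * s + n * θ) (X - μ * s)))) := by
    have h0 : (fun r => p0 a lam δ r x T y) = fun r => (fun s => exp (-(l * s)) *
        ∑' n : ℕ, (l * s) ^ n / n.factorial * gauss (α * s + n * θ) (X - μ * s)) (T - r) := by
      funext r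
      unfold p0 G Gn
      rw [hα, hθ, hl, hX, hμ]
      rfl
    have h1 : HasDerivAt (fun s => exp (-(l * s))) (-l * exp (-(l * s))) s := by
      have : HasDerivAt (fun s => -(l * s)) (-l) s := by
        simpa using ((hasDerivAt_id s).const_mul l).fun_neg
      exact this.exp.congr_deriv (by ring)
    have h2 := h1.fun_mul (hasDerivAt_time_series hα0 hθ0.le hl0 hs0 μ X)
    rw [h0]
    subst hs
    exact (h2.comp_const_sub T t).deriv
  have hint : ∫ z : ℝ, (p0 a lam δ t (x + z) T y - p0 a lam δ t x T y) *
        ((√(2 * π * θ))⁻¹ * exp (-z ^ 2 / (2 * θ))) = exp (-(l * s)) *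
      (∑' n : ℕ, (l * s) ^ n / n.factorial * gauss (α * s + n * θ + θ) (X - μ * s)
            - ∑' n : ℕ, (l * s) ^ n / n.factorial * gauss (α * s + n * θ) (X - μ * s)) := by
    have hz : ∀ z, (p0 a lam δ t (x + z) T y - p0 a lam δ t x T y) *
        ((√(2 * π * θ))⁻¹ * exp (-z ^ 2 / (2 * θ))) =
        exp (-(l * s)) * ((∑' n : ℕ, (l * s) ^ n / n.factorial *
          gauss (α * s + n * θ) (x + z - (y + μ * s))) * gauss θ z
          - (∑' n : ℕ, (l * s) ^ n / n.factorial * gauss (α * s + n * θ) (X - μ * s)) *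
            gauss θ z) := fun z => by
      rw [congrFun hu (x + z), congrFun hu x, hXm]
      unfold gauss
      ring
    simp_rw [hz]
    rw [integral_const_mul, integral_sub
      (integrable_tsum_gauss_mul_gauss hw hw0 hv₀ hv hθ0 (y + μ * s) x)
      ((integrable_gauss hθ0).const_mul _), integral_const_mul, integral_gauss hθ0,
      integral_tsum_gauss_mul_gauss hw hw0 hv₀ hv hθ0 (y + μ * s) x, hXm, mul_one]
  unfold Lop
  rw [hθ, hdt, hint, hd2, hd1]
  beta_reduce
  rw [hXm, ← hμ]
  ring

lemma conv_GB {α θ l s : ℝ} (hα : 0 < α) (hθ : 0 < θ) (hl : 0 ≤ l) (hs : 0 < s) (X : ℝ) :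
    conv θ (GB α θ l s) X = exp (-(l * s)) *
      ∑' n : ℕ, (l * s) ^ n / n.factorial * gauss (α * s + n * θ + θ) X := by
  have h := integral_tsum_gauss_mul_gauss
    (w := fun n : ℕ => (l * s) ^ n / (n.factorial : ℝ)) (v := fun n : ℕ => α * s + n * θ)
    (v₀ := α * s) (summable_pow_div_factorial _) (fun n => by positivity) (by positivity)
    (fun n => by have : 0 ≤ n * θ := by positivity
                 linarith) hθ 0 X
  simp only [sub_zero] at h
  rw [← h, ← integral_const_mul]
  unfold conv
  congr 1
  funext z
  unfold GB GBn gauss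
  ring

lemma abs_sub_le_of_abs_deriv_le {f : ℝ → ℝ} {K : ℝ} (hf : Differentiable ℝ f)
    (hK : ∀ w, |deriv f w| ≤ K) (x y : ℝ) : |f x - f y| ≤ K * |x - y| :=
  convex_univ.norm_image_sub_le_of_norm_deriv_le (fun w _ => hf w) (fun w _ => hK w)
    (Set.mem_univ y) (Set.mem_univ x)

/-- Pointwise bound on the parametrix error `L p⁰`. -/
theorem stmt17 (M c τ Ka Kl : ℝ) (hM : 1 ≤ M) (hc : 1 < c) (hτ : 0 < τ) :
    ∃ C₀ : ℝ, 0 < C₀ ∧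
      ∀ (δ : ℝ) (a lam : ℝ → ℝ),
        0 < δ → M⁻¹ ≤ δ ^ 2 → δ ^ 2 ≤ M →
        (∀ w : ℝ, M⁻¹ ≤ a w) → (∀ w : ℝ, a w ≤ M) →
        (∀ w : ℝ, 0 ≤ lam w) → (∀ w : ℝ, lam w ≤ M) →
        Differentiable ℝ a → Differentiable ℝ lam →
        (∀ w : ℝ, |deriv a w| ≤ Ka) → (∀ w : ℝ, |deriv lam w| ≤ Kl) →
        ∀ x y t T : ℝ, t < T → T - t ≤ τ →
          |Lop a lam δ (fun s w => p0 a lam δ s w T y) t x| ≤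
            C₀ * ((T - t) ^ (-(1 : ℝ) / 2) * GB (c * M) (c * M) (c * M) (T - t) (x - y)
              + (⨆ w : ℝ, |deriv lam w|) *
                  conv (c * M) (GB (c * M) (c * M) (c * M) (T - t)) (x - y)) := by
  set μ₀ : ℝ := M + M * exp M with hμ₀
  obtain ⟨D, hD, hDb⟩ := exists_series_bound (M := M) (c := c) (μ₀ := μ₀) hM hc hτ
  have hM0 : 0 < M := by linarith
  have hc0 : 0 < c := by linarith
  set E : ℝ := exp (c * M * τ) with hE
  refine ⟨E * D * (|Ka| + 2 * M + M * exp M + 1), by positivity, ?_⟩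
  intro δ a lam hδ hδl hδu hal hau hll hlu ha hlam hKa hKl x y t T htT hTτ
  have hs : 0 < T - t := by linarith
  have hMi : 0 < M⁻¹ := by positivity
  have hexp1 : 1 ≤ exp (δ ^ 2 / 2) := Real.one_le_exp (by positivity)
  have hexpM : exp (δ ^ 2 / 2) ≤ exp M := Real.exp_le_exp.2 (by linarith)
  have hμ0 : 0 ≤ a y / 2 + lam y * (exp (δ ^ 2 / 2) - 1) := by
    have := mul_nonneg (hll y) (by linarith : 0 ≤ exp (δ ^ 2 / 2) - 1)
    linarith [hal y]
  have hμ1 : a y / 2 + lam y * (exp (δ ^ 2 / 2) - 1) ≤ μ₀ := by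
    have : lam y * (exp (δ ^ 2 / 2) - 1) ≤ M * exp M :=
      mul_le_mul (hlu y) (by linarith) (by linarith) hM0.le
    linarith [hau y]
  rw [Lop_p0 (hMi.trans_le (hal y)) (by positivity : 0 < δ ^ 2) (hll y) hs rfl rfl rfl rfl rfl rfl,
    conv_GB (by positivity) (by positivity) (by positivity) hs]
  obtain ⟨h0, h1, h2, h3⟩ := hDb (a y) (δ ^ 2) (lam y) (T - t) _ (x - y) (hal y) (hau y) hδl hδu
    (hll y) (hlu y) hs hTτ hμ0 hμ1
  have hGB : GB (c * M) (c * M) (c * M) (T - t) (x - y) = exp (-(c * M * (T - t))) *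
      ∑' n : ℕ, (c * M * (T - t)) ^ n / n.factorial *
        gauss (c * M * (T - t) + n * (c * M)) (x - y) := rfl
  have hpow : (T - t) ^ (-(1 : ℝ) / 2) = 1 / √(T - t) := by
    rw [neg_div, Real.rpow_neg hs.le, ← Real.sqrt_eq_rpow, one_div]
  rw [hGB, hpow]
  have hbdd : BddAbove (Set.range fun w => |deriv lam w|) :=
    ⟨Kl, by rintro _ ⟨w, rfl⟩; exact hKl w⟩
  have hla := abs_sub_le_of_abs_deriv_le hlam (fun w => le_ciSup hbdd w) x y
  have haa : |a x - a y| ≤ |Ka| * |x - y| :=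
    abs_sub_le_of_abs_deriv_le ha (fun w => (hKa w).trans (le_abs_self Ka)) x y
  have hΛ0 : 0 ≤ ⨆ w, |deriv lam w| := Real.iSup_nonneg fun _ => abs_nonneg _
  set Λ : ℝ := ⨆ w, |deriv lam w| with hΛ
  have haM : |a x - a y| ≤ M := by
    rw [abs_le]
    constructor <;> linarith [hal x, hal y, hau x, hau y]
  have hlM : |lam x - lam y| ≤ M := by
    rw [abs_le]
    constructor <;> linarith [hll x, hll y, hlu x, hlu y]
  have hw0 : ∀ n : ℕ, 0 ≤ (c * M * (T - t)) ^ n / (n.factorial : ℝ) := fun n => by positivity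
  have hB0 : 0 ≤ ∑' n : ℕ, (c * M * (T - t)) ^ n / n.factorial *
        gauss (c * M * (T - t) + n * (c * M)) (x - y) :=
    tsum_nonneg fun n => mul_nonneg (hw0 n) (gauss_nonneg _ _)
  have hB0' : 0 ≤ ∑' n : ℕ, (c * M * (T - t)) ^ n / n.factorial *
        gauss (c * M * (T - t) + n * (c * M) + c * M) (x - y) :=
    tsum_nonneg fun n => mul_nonneg (hw0 n) (gauss_nonneg _ _)
  have hEE : 1 ≤ E * exp (-(c * M * (T - t))) := by
    rw [hE, ← Real.exp_add]
    apply Real.one_le_exp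
    have : c * M * (T - t) ≤ c * M * τ := by gcongr
    linarith
  have hE1 : exp (-(lam y * (T - t))) ≤ 1 :=
    Real.exp_le_one_iff.2 (by have := mul_nonneg (hll y) hs.le
                              linarith)
  have hex : |exp (δ ^ 2 / 2) - 1| ≤ exp M := by
    rw [abs_of_nonneg (by linarith)]
    linarith
  set S0 := ∑' n : ℕ, (lam y * (T - t)) ^ n / n.factorial * gauss (a y * (T - t) + n * δ ^ 2)
    (x - y - (a y / 2 + lam y * (exp (δ ^ 2 / 2) - 1)) * (T - t))
  set S1 := ∑' n : ℕ, (lam y * (T - t)) ^ n / n.factorial *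
    (-(x - y - (a y / 2 + lam y * (exp (δ ^ 2 / 2) - 1)) * (T - t)) /
      (a y * (T - t) + n * δ ^ 2) * gauss (a y * (T - t) + n * δ ^ 2)
    (x - y - (a y / 2 + lam y * (exp (δ ^ 2 / 2) - 1)) * (T - t)))
  set S2 := ∑' n : ℕ, (lam y * (T - t)) ^ n / n.factorial *
    (((x - y - (a y / 2 + lam y * (exp (δ ^ 2 / 2) - 1)) * (T - t)) ^ 2 /
      (a y * (T - t) + n * δ ^ 2) ^ 2 - 1 / (a y * (T - t) + n * δ ^ 2)) *
      gauss (a y * (T - t) + n * δ ^ 2)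
    (x - y - (a y / 2 + lam y * (exp (δ ^ 2 / 2) - 1)) * (T - t)))
  set SJ := ∑' n : ℕ, (lam y * (T - t)) ^ n / n.factorial *
    gauss (a y * (T - t) + n * δ ^ 2 + δ ^ 2)
    (x - y - (a y / 2 + lam y * (exp (δ ^ 2 / 2) - 1)) * (T - t))
  set B := ∑' n : ℕ, (c * M * (T - t)) ^ n / n.factorial *
        gauss (c * M * (T - t) + n * (c * M)) (x - y)
  set BJ := ∑' n : ℕ, (c * M * (T - t)) ^ n / n.factorial *
        gauss (c * M * (T - t) + n * (c * M) + c * M) (x - y)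
  set b : ℝ := D / √(T - t) * B with hb
  have hb0 : 0 ≤ b := by positivity
  have t2 : |(a x - a y) / 2 * S2| ≤ |Ka| * b := by
    rw [abs_mul, abs_div, abs_two]
    calc |a x - a y| / 2 * |S2| ≤ |Ka| * |x - y| / 2 * |S2| := by gcongr
      _ = |Ka| * (|x - y| * |S2|) / 2 := by ring
      _ ≤ |Ka| * b / 2 := by gcongr
      _ ≤ |Ka| * b := half_le_self (by positivity)
  have t1 : |(a x - a y) / 2 * S1| ≤ M * b := by
    rw [abs_mul, abs_div, abs_two]
    calc |a x - a y| / 2 * |S1| ≤ M / 2 * b := by gcongr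
      _ ≤ M * b := by gcongr; linarith
  have t1' : |(lam x - lam y) * (exp (δ ^ 2 / 2) - 1) * S1| ≤ M * exp M * b := by
    rw [abs_mul, abs_mul]
    gcongr
  have t0 : |(lam x - lam y) * S0| ≤ M * b := by
    rw [abs_mul]
    gcongr
  have tJ : |(lam x - lam y) * SJ| ≤ Λ * (D * BJ) := by
    rw [abs_mul]
    calc |lam x - lam y| * |SJ| ≤ Λ * |x - y| * |SJ| := by gcongr
      _ = Λ * (|x - y| * |SJ|) := by ring
      _ ≤ Λ * (D * BJ) := by gcongr
  have hsum : |(a x - a y) / 2 * (S2 - S1) - (lam x - lam y) * (exp (δ ^ 2 / 2) - 1) * S1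
      + (lam x - lam y) * (SJ - S0)| ≤ (|Ka| + 2 * M + M * exp M) * b + Λ * (D * BJ) := by
    rw [abs_le] at t2 t1 t1' t0 tJ ⊢
    constructor <;> linarith
  have hC : 0 ≤ |Ka| + 2 * M + M * exp M := by positivity
  have hΛB : 0 ≤ Λ * (D * BJ) := by positivity
  rw [abs_mul, abs_of_nonneg (exp_nonneg _)]
  calc _ ≤ 1 * ((|Ka| + 2 * M + M * exp M) * b + Λ * (D * BJ)) := by gcongr
    _ ≤ E * exp (-(c * M * (T - t))) * ((|Ka| + 2 * M + M * exp M + 1) * b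
        + (|Ka| + 2 * M + M * exp M + 1) * (Λ * (D * BJ))) := by
      refine mul_le_mul hEE (add_le_add ?_ ?_) (by positivity) (by positivity)
      · exact mul_le_mul_of_nonneg_right (by linarith) hb0
      · refine le_mul_of_one_le_left hΛB ?_
        have : 0 ≤ M * exp M := by positivity
        linarith [abs_nonneg Ka]
    _ = _ := by rw [hb]; ring
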